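/- Let E be a tetrahedron and k ≥ 2. The space Z_k := {z ∈ (P_k)^3 : z·n = 0 on ∂E and div z = 0 in E} has dimension 3π_{k-2,3} − π_{k-3,3}, where π_{s,3} = (s+1)(s+2)(s+3)/6 (and π_{s,3}=0 for s<0); equivalently, Z_k equals curl(C_{k+1}), where C_{k+1} is the span over i=1,…,4 of the 'cup' fields b_3^{(-i)} p n_i with p a polynomial of degree at most k−2, b_3^{(-i)} the product of the three affine face functions λ_j (j ≠ i), and n_i the outward unit normal to face f_i. -/

import Mathlib

open MvPolynomial Finset

/-- `π_{s,3}` : dimension of trivariate polynomials of degree `≤ s`, `0` for `s < 0`. -/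
def pi3 (s : ℤ) : ℤ := if 0 ≤ s then (s + 1) * (s + 2) * (s + 3) / 6 else 0

/-- divergence, as a linear map on trivariate polynomial vector fields -/
noncomputable def divL :
    (Fin 3 → MvPolynomial (Fin 3) ℝ) →ₗ[ℝ] MvPolynomial (Fin 3) ℝ :=
  ∑ i, (pderiv (R := ℝ) i).toLinearMap.comp (LinearMap.proj i)

/-- curl, as a linear map on trivariate polynomial vector fields -/
noncomputable def curlL :
    (Fin 3 → MvPolynomial (Fin 3) ℝ) →ₗ[ℝ] (Fin 3 → MvPolynomial (Fin 3) ℝ) :=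
  LinearMap.pi
    ![(pderiv (R := ℝ) (1 : Fin 3)).toLinearMap.comp (LinearMap.proj 2) -
        (pderiv (R := ℝ) (2 : Fin 3)).toLinearMap.comp (LinearMap.proj 1),
      (pderiv (R := ℝ) (2 : Fin 3)).toLinearMap.comp (LinearMap.proj 0) -
        (pderiv (R := ℝ) (0 : Fin 3)).toLinearMap.comp (LinearMap.proj 2),
      (pderiv (R := ℝ) (0 : Fin 3)).toLinearMap.comp (LinearMap.proj 1) -
        (pderiv (R := ℝ) (1 : Fin 3)).toLinearMap.comp (LinearMap.proj 0)]

/-- the linear functional `z ↦ (z·ν)(x)` on polynomial vector fields,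
for a fixed vector `ν` and point `x` -/
noncomputable def normalEvalL (ν : Fin 3 → ℝ) (x : Fin 3 → ℝ) :
    (Fin 3 → MvPolynomial (Fin 3) ℝ) →ₗ[ℝ] ℝ :=
  ∑ l, (ν l) • ((aeval x).toLinearMap.comp (LinearMap.proj l))

/-- the space `Z_k` of polynomial fields of degree `≤ k`, divergence free, with
vanishing normal component on each face (the face `f_i` of the tetrahedron with
vertices `v` being the convex hull of the vertices other than `v i`). -/
noncomputable def Zspace (k : ℕ) (v : Fin 4 → Fin 3 → ℝ) (n : Fin 4 → Fin 3 → ℝ) :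
    Submodule ℝ (Fin 3 → MvPolynomial (Fin 3) ℝ) :=
  (Submodule.pi Set.univ fun _ : Fin 3 => restrictTotalDegree (Fin 3) ℝ k) ⊓
    LinearMap.ker divL ⊓
    ⨅ (i : Fin 4), ⨅ x ∈ convexHull ℝ (v '' {j | j ≠ i}),
      LinearMap.ker (normalEvalL (n i) x)

/-- the space `C_s` spanned by the "cup" fields `b₃^{(-i)} p n_i`, `p ∈ P_{s-3}`. -/
noncomputable def Cspace (s : ℕ) (n : Fin 4 → Fin 3 → ℝ)
    (lam : Fin 4 → MvPolynomial (Fin 3) ℝ) :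
    Submodule ℝ (Fin 3 → MvPolynomial (Fin 3) ℝ) :=
  Submodule.span ℝ
    {w | ∃ (i : Fin 4) (p : MvPolynomial (Fin 3) ℝ), p.totalDegree ≤ s - 3 ∧
      w = fun l => C (n i l) * ((∏ j ∈ univ.erase i, lam j) * p)}

/-- trivariate polynomials of total degree `< m` -/
noncomputable def polyLT (m : ℕ) : Submodule ℝ (MvPolynomial (Fin 3) ℝ) :=
  restrictSupport ℝ {a | a.degree < m}

theorem mem_polyLT_iff {m : ℕ} {f : MvPolynomial (Fin 3) ℝ} :
    f ∈ polyLT m ↔ ∀ a, coeff a f ≠ 0 → a.degree < m := by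
  simp [polyLT, mem_restrictSupport_iff, Set.subset_def]

theorem mem_polyLT_succ_iff {m : ℕ} {f : MvPolynomial (Fin 3) ℝ} :
    f ∈ polyLT (m + 1) ↔ f.totalDegree ≤ m := by
  rw [← mem_restrictTotalDegree]
  simp [polyLT, restrictTotalDegree, mem_restrictSupport_iff, Set.subset_def,
    Finsupp.degree_eq_sum, Finsupp.sum_fintype]

theorem finite_setOf_degree_lt (m : ℕ) : {a : Fin 3 →₀ ℕ | a.degree < m}.Finite := by
  refine ((range m).biUnion fun d => univ.finsuppAntidiag d).finite_toSet.subset fun a ha => ?_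
  simpa [Finsupp.degree_eq_sum] using ha

instance (m : ℕ) : Module.Finite ℝ (polyLT m) :=
  have := (finite_setOf_degree_lt m).to_subtype
  Module.Finite.of_basis (basisRestrictSupport ℝ {a : Fin 3 →₀ ℕ | a.degree < m})

theorem finrank_polyLT (m : ℕ) : Module.finrank ℝ (polyLT m) = (m + 2).choose 3 := by
  have h : {a : Fin 3 →₀ ℕ | a.degree < m} =
      ((range m).biUnion fun d => (univ : Finset (Fin 3)).finsuppAntidiag d : Set _) := by
    ext a
    simp [Finsupp.degree_eq_sum]
  change Module.finrank ℝ (restrictSupport ℝ {a : Fin 3 →₀ ℕ | a.degree < m}) = _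
  rw [Module.finrank_eq_nat_card_basis
    (basisRestrictSupport ℝ {a : Fin 3 →₀ ℕ | a.degree < m}), Nat.card_coe_set_eq, h,
    Set.ncard_coe_finset, card_biUnion]
  · simp only [card_finsuppAntidiag_nat_eq_choose, card_univ, Fintype.card_fin]
    induction m with
    | zero => rfl
    | succ m ih =>
      rw [sum_range_succ, ih (by ext; simp [Finsupp.degree_eq_sum]),
        show 3 + m - 1 = m + 2 by omega, Nat.choose_symm_add,
        show m + 1 + 2 = (m + 2) + 1 by ring, Nat.choose_succ_succ' (m + 2) 2, add_comm]
  · intro d _ e _ hde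
    refine Finset.disjoint_left.2 fun a ha hb => hde ?_
    simp only [mem_finsuppAntidiag] at ha hb
    rw [← ha.1, ← hb.1]

theorem mul_mem_polyLT {p q : ℕ} {f g : MvPolynomial (Fin 3) ℝ} (hf : f ∈ polyLT (p + 1))
    (hg : g ∈ polyLT q) : f * g ∈ polyLT (p + q) := by
  cases q with
  | zero =>
    have : g = 0 := by
      ext a
      by_contra h
      exact absurd (mem_polyLT_iff.1 hg a h) (by simp)
    simp [this]
  | succ q =>
    rw [mem_polyLT_succ_iff] at hf hg
    rw [← add_assoc, mem_polyLT_succ_iff]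
    exact (totalDegree_mul f g).trans (add_le_add hf hg)

theorem mem_polyLT_of_mul_mem {m : ℕ} {l f : MvPolynomial (Fin 3) ℝ}
    (hl : l.totalDegree = 1) (h : l * f ∈ polyLT (m + 1)) : f ∈ polyLT m := by
  rcases eq_or_ne f 0 with rfl | hf
  · exact zero_mem _
  have hl0 : l ≠ 0 := by rintro rfl; simp at hl
  rw [mem_polyLT_succ_iff, totalDegree_mul_of_isDomain hl0 hf, hl] at h
  obtain ⟨n, rfl⟩ : ∃ n, m = n + 1 := ⟨m - 1, by omega⟩
  rw [mem_polyLT_succ_iff]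
  omega

theorem pderiv_mem_polyLT {m : ℕ} {f : MvPolynomial (Fin 3) ℝ} (hf : f ∈ polyLT (m + 1))
    (i : Fin 3) : pderiv i f ∈ polyLT m := by
  rw [mem_polyLT_iff] at hf ⊢
  intro a ha
  rw [coeff_pderiv] at ha
  have := hf _ (left_ne_zero_of_mul ha)
  simpa using this

theorem mem_polyLT_of_pderiv_mem {m : ℕ} {f : MvPolynomial (Fin 3) ℝ}
    (hf : ∀ i, pderiv i f ∈ polyLT m) : f ∈ polyLT (m + 1) := by
  rw [mem_polyLT_iff]
  intro a ha
  rcases eq_or_ne a 0 with rfl | h0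
  · simp
  obtain ⟨i, hi⟩ := Finsupp.ne_iff.1 h0
  obtain ⟨b, rfl⟩ : ∃ b, a = b + Finsupp.single i 1 :=
    ⟨a - Finsupp.single i 1, (tsub_add_cancel_of_le (by
      simpa [Nat.one_le_iff_ne_zero] using hi)).symm⟩
  have := mem_polyLT_iff.1 (hf i) b (by
    rw [coeff_pderiv]
    exact mul_ne_zero ha (by positivity))
  simpa using this

theorem exists_eq_C_of_pderiv_eq_zero {f : MvPolynomial (Fin 3) ℝ} (hf : ∀ i, pderiv i f = 0) :
    ∃ r, f = C r :=
  ⟨_, totalDegree_eq_zero_iff_eq_C.1 (Nat.le_zero.1 (mem_polyLT_succ_iff.1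
    (mem_polyLT_of_pderiv_mem fun i => by rw [hf i]; exact zero_mem _)))⟩

theorem coeff_sum_X_mul_pderiv (f : MvPolynomial (Fin 3) ℝ) (a : Fin 3 →₀ ℕ) :
    coeff a (∑ j, X j * pderiv j f) = a.degree * coeff a f := by
  have key (j : Fin 3) : coeff a (X j * pderiv j f) = a j * coeff a f := by
    rw [coeff_X_mul']
    split_ifs with h
    · have hle : Finsupp.single j 1 ≤ a := by
        simpa [Nat.one_le_iff_ne_zero] using h
      rw [coeff_pderiv, tsub_add_cancel_of_le hle, mul_comm]
      congr 1
      have := Finsupp.mem_support_iff.1 h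
      rw [Finsupp.tsub_apply, Finsupp.single_eq_same, Nat.cast_sub (by omega)]
      simp
    · simp [Finsupp.notMem_support_iff.1 h]
  simp [coeff_sum, key, Finsupp.degree_eq_sum, sum_mul]

/-- Poincaré lemma for polynomial vector fields. -/
theorem exists_potential (A : Fin 3 → MvPolynomial (Fin 3) ℝ)
    (hA : ∀ i j, pderiv i (A j) = pderiv j (A i)) : ∃ φ, ∀ i, pderiv i φ = A i := by
  set g := ∑ j, X j * A j with hg
  refine ⟨∑ a ∈ g.support, monomial a (coeff a g / a.degree), fun i => ?_⟩
  have hpd : pderiv i g = A i + ∑ j, X j * pderiv j (A i) := by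
    simp only [hg, map_sum, pderiv_mul, sum_add_distrib, pderiv_X, hA i]
    congr 1
    rw [Finset.sum_eq_single i]
    · simp
    · intro j _ hj
      simp [hj]
    · simp
  ext a
  have hc (b : Fin 3 →₀ ℕ) : coeff b (∑ a ∈ g.support, monomial a (coeff a g / a.degree)) =
      coeff b g / b.degree := by
    simp only [coeff_sum, coeff_monomial, sum_ite_eq', mem_support_iff]
    split_ifs with h
    · rfl
    · simp [not_not.1 h]
  have h1 := congrArg (coeff a) hpd
  rw [coeff_add, coeff_sum_X_mul_pderiv, coeff_pderiv] at h1
  rw [coeff_pderiv, hc, div_mul_eq_mul_div, h1, map_add, Finsupp.degree_single]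
  push_cast
  field_simp
  ring

/-- the polynomial `x ↦ c + m · x` -/
noncomputable def affPoly (c : ℝ) (m : Fin 3 → ℝ) : MvPolynomial (Fin 3) ℝ :=
  C c + ∑ j, C (m j) * X j

/-- the derivative in the direction `a` -/
noncomputable def dirDeriv (a : Fin 3 → ℝ) :
    Derivation ℝ (MvPolynomial (Fin 3) ℝ) (MvPolynomial (Fin 3) ℝ) :=
  a 0 • pderiv 0 + a 1 • pderiv 1 + a 2 • pderiv 2

theorem dirDeriv_apply (a : Fin 3 → ℝ) (f : MvPolynomial (Fin 3) ℝ) :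
    dirDeriv a f = ∑ l, C (a l) * pderiv l f := by
  simp [dirDeriv, Fin.sum_univ_three, smul_eq_C_mul]

theorem eval_affPoly (c : ℝ) (m x : Fin 3 → ℝ) :
    eval x (affPoly c m) = c + ∑ l, m l * x l := by
  simp [affPoly]

theorem pderiv_affPoly (c : ℝ) (m : Fin 3 → ℝ) (j : Fin 3) :
    pderiv j (affPoly c m) = C (m j) := by
  simp only [affPoly, map_add, pderiv_C, zero_add, map_sum, pderiv_C_mul]
  rw [Finset.sum_eq_single j]
  · simp
  · intro b _ hb
    simp [hb]
  · simp

theorem dirDeriv_affPoly (a : Fin 3 → ℝ) (c : ℝ) (m : Fin 3 → ℝ) :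
    dirDeriv a (affPoly c m) = C (∑ l, m l * a l) := by
  simp [dirDeriv_apply, pderiv_affPoly, mul_comm]

theorem affPoly_mem_polyLT (c : ℝ) (m : Fin 3 → ℝ) : affPoly c m ∈ polyLT 2 :=
  mem_polyLT_of_pderiv_mem fun i => by
    rw [pderiv_affPoly, mem_polyLT_succ_iff, totalDegree_C]

theorem totalDegree_affPoly {c : ℝ} {m t : Fin 3 → ℝ} (hmt : ∑ l, m l * t l = 1) :
    (affPoly c m).totalDegree = 1 := by
  have h1 := mem_polyLT_succ_iff.1 (affPoly_mem_polyLT c m)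
  refine h1.antisymm (Nat.one_le_iff_ne_zero.2 fun h0 => ?_)
  have h2 := dirDeriv_affPoly t c m
  rw [totalDegree_eq_zero_iff_eq_C.1 h0, derivation_C, hmt, C_1] at h2
  exact zero_ne_one h2

theorem affPoly_ne_zero {c : ℝ} {m t : Fin 3 → ℝ} (hmt : ∑ l, m l * t l = 1) :
    affPoly c m ≠ 0 := fun h => by
  simpa [h] using totalDegree_affPoly (c := c) hmt

/-- precomposition with the projection onto the plane `c + m · x = 0` along `t`
(where `m · t = 1`) -/
noncomputable def planeProj (c : ℝ) (m t : Fin 3 → ℝ) :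
    MvPolynomial (Fin 3) ℝ →ₐ[ℝ] MvPolynomial (Fin 3) ℝ :=
  aeval fun l => X l - C (t l) * affPoly c m

theorem affPoly_dvd_sub_planeProj (c : ℝ) (m t : Fin 3 → ℝ) (f : MvPolynomial (Fin 3) ℝ) :
    affPoly c m ∣ f - planeProj c m t f := by
  have h : (Ideal.Quotient.mkₐ ℝ (Ideal.span {affPoly c m})).comp (planeProj c m t) =
      Ideal.Quotient.mkₐ ℝ (Ideal.span {affPoly c m}) := by
    refine MvPolynomial.algHom_ext fun l => ?_
    simp only [planeProj, AlgHom.comp_apply, aeval_X, Ideal.Quotient.mkₐ_eq_mk]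
    rw [Ideal.Quotient.mk_eq_mk_iff_sub_mem, Ideal.mem_span_singleton]
    exact ⟨-C (t l), by ring⟩
  have h2 := DFunLike.congr_fun h f
  simp only [AlgHom.comp_apply, Ideal.Quotient.mkₐ_eq_mk] at h2
  exact Ideal.mem_span_singleton.1 (Ideal.Quotient.mk_eq_mk_iff_sub_mem _ _ |>.1 h2.symm)

theorem planeProj_affPoly {c : ℝ} {m t : Fin 3 → ℝ} (hmt : ∑ l, m l * t l = 1) :
    planeProj c m t (affPoly c m) = 0 := by
  have h : ∑ j, C (m j) * (X j - C (t j) * affPoly c m) =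
      ∑ j, C (m j) * X j - C (∑ j, m j * t j) * affPoly c m := by
    simp only [map_sum, C_mul, sum_mul, ← sum_sub_distrib]
    exact sum_congr rfl fun j _ => by ring
  have e : planeProj c m t (affPoly c m) =
      C c + ∑ j, C (m j) * (X j - C (t j) * affPoly c m) := by
    change planeProj c m t (C c + ∑ j, C (m j) * X j) = _
    simp [planeProj]
  rw [e, h, hmt, affPoly]
  simp

theorem affPoly_dvd_iff {c : ℝ} {m t : Fin 3 → ℝ} (hmt : ∑ l, m l * t l = 1)
    {f : MvPolynomial (Fin 3) ℝ} : affPoly c m ∣ f ↔ planeProj c m t f = 0 := by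
  constructor
  · rintro ⟨g, rfl⟩
    rw [map_mul, planeProj_affPoly hmt, zero_mul]
  · intro h
    simpa [h] using affPoly_dvd_sub_planeProj c m t f

theorem prime_affPoly {c : ℝ} {m t : Fin 3 → ℝ} (hmt : ∑ l, m l * t l = 1) :
    Prime (affPoly c m) := by
  refine ⟨affPoly_ne_zero hmt, fun h => ?_, fun f g hfg => ?_⟩
  · have h1 := (affPoly_dvd_iff hmt).1 (h.dvd (a := 1))
    simp at h1
  · simpa only [affPoly_dvd_iff hmt, map_mul, mul_eq_zero] using hfg

theorem affPoly_dvd_of_eval_eq_zero {c : ℝ} {m t : Fin 3 → ℝ} (hmt : ∑ l, m l * t l = 1)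
    {f : MvPolynomial (Fin 3) ℝ}
    (hf : ∀ x, eval x (affPoly c m) = 0 → eval x f = 0) : affPoly c m ∣ f := by
  rw [affPoly_dvd_iff hmt]
  refine MvPolynomial.funext fun x => ?_
  have key (g : MvPolynomial (Fin 3) ℝ) : eval x (planeProj c m t g) =
      eval (fun l => x l - t l * eval x (affPoly c m)) g := by
    induction g using MvPolynomial.induction_on with
    | C r => simp [planeProj]
    | add p q hp hq => simp only [map_add, hp, hq]
    | mul_X p i hp =>
      rw [map_mul, map_mul, map_mul, hp]
      simp [planeProj]
  rw [key, map_zero]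
  refine hf _ ?_
  rw [← key, planeProj_affPoly hmt, map_zero]

theorem pderiv_planeProj (c : ℝ) (m t : Fin 3 → ℝ) (j : Fin 3) (f : MvPolynomial (Fin 3) ℝ) :
    pderiv j (planeProj c m t f) =
      planeProj c m t (pderiv j f) - C (m j) * planeProj c m t (dirDeriv t f) := by
  induction f using MvPolynomial.induction_on with
  | C r => simp [planeProj, derivation_C]
  | add p q hp hq =>
    simp only [map_add, hp, hq]
    ring
  | mul_X p i hp =>
    have hX : planeProj c m t (X i) = X i - C (t i) * affPoly c m := by simp [planeProj]
    have ht : dirDeriv t (X i : MvPolynomial (Fin 3) ℝ) = C (t i) := by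
      rw [dirDeriv_apply, Finset.sum_eq_single i]
      · simp
      · intro b _ hb
        simp [hb.symm]
      · simp
    have hC (r : ℝ) : planeProj c m t (C r) = C r := by simp [planeProj]
    have hs : planeProj c m t (pderiv j (X i)) = pderiv j (X i) := by
      rcases eq_or_ne i j with rfl | h
      · simp
      · simp [pderiv_X_of_ne h]
    simp only [Derivation.leibniz, smul_eq_mul, map_add, map_mul, hp, hX, ht, hC, hs, map_sub,
      pderiv_C, pderiv_affPoly]
    ring

/-- A polynomial whose tangential derivatives vanish on a plane is constant on that plane. -/
theorem exists_affPoly_dvd_sub_C {c : ℝ} {m t : Fin 3 → ℝ} (hmt : ∑ l, m l * t l = 1)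
    {f g : MvPolynomial (Fin 3) ℝ} (hf : ∀ j, affPoly c m ∣ pderiv j f - C (m j) * g) :
    ∃ r, affPoly c m ∣ f - C r := by
  have hj (j : Fin 3) : planeProj c m t (pderiv j f) = C (m j) * planeProj c m t g := by
    have := (affPoly_dvd_iff hmt).1 (hf j)
    rw [map_sub, map_mul, sub_eq_zero] at this
    rw [this]
    simp [planeProj]
  have ht : planeProj c m t (dirDeriv t f) = planeProj c m t g := by
    have hC (r : ℝ) : planeProj c m t (C r) = C r := by simp [planeProj]
    simp only [dirDeriv_apply, map_sum, map_mul, hj, hC]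
    calc _ = C (∑ l, m l * t l) * planeProj c m t g := by
          simp only [map_sum, C_mul, sum_mul]
          exact sum_congr rfl fun l _ => by ring
      _ = _ := by rw [hmt, C_1, one_mul]
  obtain ⟨r, hr⟩ := exists_eq_C_of_pderiv_eq_zero (f := planeProj c m t f) fun j => by
    rw [pderiv_planeProj, hj, ht, sub_self]
  exact ⟨r, hr ▸ affPoly_dvd_sub_planeProj c m t f⟩

theorem polynomial_eval_aeval {σ : Type*} (u : σ → Polynomial ℝ) (f : MvPolynomial σ ℝ) (s : ℝ) :
    (aeval u f).eval s = eval (fun l => (u l).eval s) f := by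
  induction f using MvPolynomial.induction_on with
  | C r => simp
  | add p q hp hq => simp [hp, hq]
  | mul_X p l hp => simp [hp]

/-- `c i + m i · x` are the barycentric coordinates of the tetrahedron with vertices `v` -/
structure IsBarycentric (v m : Fin 4 → Fin 3 → ℝ) (c : Fin 4 → ℝ) : Prop where
  eval_vertex : ∀ i j, c i + ∑ l, m i l * v j l = if i = j then 1 else 0
  sum_const : ∑ i, c i = 1
  sum_grad : ∀ j, ∑ i, m i j = 0
  sum_const_mul : ∀ l, ∑ i, v i l * c i = 0
  sum_grad_mul : ∀ l j, ∑ i, v i l * m i j = if l = j then 1 else 0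

theorem isBarycentric_of_eval_vertex {v m : Fin 4 → Fin 3 → ℝ} {c : Fin 4 → ℝ}
    (h : ∀ i j, c i + ∑ l, m i l * v j l = if i = j then 1 else 0) : IsBarycentric v m c := by
  let N : Matrix (Fin 4) (Fin 4) ℝ := Matrix.of fun i => Fin.cons (c i) (m i)
  let M : Matrix (Fin 4) (Fin 4) ℝ := (Matrix.of fun j => Fin.cons 1 (v j)).transpose
  have hNM : N * M = 1 := by
    ext i j
    rw [Matrix.mul_apply, Fin.sum_univ_succ, Matrix.one_apply, ← h i j]
    simp [N, M]
  have hMN (a b : Fin 4) : ∑ i, M a i * N i b = if a = b then 1 else 0 := by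
    rw [← Matrix.mul_apply, mul_eq_one_comm.1 hNM, Matrix.one_apply]
  refine ⟨h, ?_, fun j => ?_, fun l => ?_, fun l j => ?_⟩
  · simpa [N, M] using hMN 0 0
  · simpa [N, M, (Fin.succ_ne_zero j).symm] using hMN 0 j.succ
  · simpa [N, M] using hMN l.succ 0
  · simpa [N, M] using hMN l.succ j.succ

namespace IsBarycentric

variable {v m : Fin 4 → Fin 3 → ℝ} {c : Fin 4 → ℝ}

theorem exists_transversal (h : IsBarycentric v m c) (i : Fin 4) :
    ∃ t : Fin 3 → ℝ, ∑ l, m i l * t l = 1 := by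
  obtain ⟨j, hj⟩ := exists_ne i
  refine ⟨fun l => v i l - v j l, ?_⟩
  have h1 := h.eval_vertex i i
  have h2 := h.eval_vertex i j
  simp only [mul_sub, sum_sub_distrib]
  simp only [hj.symm, if_true, if_false] at h1 h2
  linarith

theorem sum_affPoly (h : IsBarycentric v m c) : ∑ i, affPoly (c i) (m i) = 1 := by
  simp only [affPoly, sum_add_distrib, ← map_sum, h.sum_const, C_1]
  rw [sum_comm]
  simp [← sum_mul, ← map_sum, h.sum_grad]

theorem sum_mul_affPoly (h : IsBarycentric v m c) (l : Fin 3) :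
    ∑ i, C (v i l) * affPoly (c i) (m i) = X l := by
  simp only [affPoly, mul_add, sum_add_distrib, ← C_mul, ← map_sum, h.sum_const_mul, mul_sum,
    ← mul_assoc]
  rw [sum_comm]
  simp only [← sum_mul, ← map_sum, h.sum_grad_mul]
  simp

theorem sum_dot (h : IsBarycentric v m c) (z : Fin 3 → MvPolynomial (Fin 3) ℝ) :
    ∑ i, ∑ l, C (m i l) * z l = 0 := by
  rw [sum_comm]
  simp [← sum_mul, ← map_sum, h.sum_grad]

theorem sum_mul_dot (h : IsBarycentric v m c) (z : Fin 3 → MvPolynomial (Fin 3) ℝ) (l : Fin 3) :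
    ∑ i, C (v i l) * ∑ j, C (m i j) * z j = z l := by
  simp only [mul_sum, ← mul_assoc, ← C_mul]
  rw [sum_comm]
  simp only [← sum_mul, ← map_sum, h.sum_grad_mul]
  simp

theorem affPoly_dvd_of_eval_face (h : IsBarycentric v m c) (i : Fin 4)
    {f : MvPolynomial (Fin 3) ℝ}
    (hf : ∀ x ∈ convexHull ℝ (v '' {j | j ≠ i}), eval x f = 0) : affPoly (c i) (m i) ∣ f := by
  obtain ⟨t, ht⟩ := h.exists_transversal i
  refine affPoly_dvd_of_eval_eq_zero ht fun x hx => ?_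
  set a : Fin 4 → ℝ := fun j => eval x (affPoly (c j) (m j)) with ha
  have hai : a i = 0 := hx
  have hsum : ∑ j ∈ univ.erase i, a j = 1 := by
    have := congrArg (eval x) h.sum_affPoly
    rw [map_sum, map_one] at this
    rw [← this, ← add_sum_erase _ _ (mem_univ i)]
    simp [ha, hx]
  have hxv (l : Fin 3) : ∑ j ∈ univ.erase i, a j * v j l = x l := by
    have := congrArg (eval x) (h.sum_mul_affPoly l)
    rw [map_sum, eval_X] at this
    rw [← this, ← add_sum_erase _ _ (mem_univ i)]
    simp [ha, hx, mul_comm]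
  let P : Polynomial ℝ := aeval (fun l => ∑ j ∈ univ.erase i,
    (Polynomial.C (1 / 3) + Polynomial.X * Polynomial.C (a j - 1 / 3)) * Polynomial.C (v j l)) f
  have hP (s : ℝ) : P.eval s =
      eval (fun l => ∑ j ∈ univ.erase i, (1 / 3 + s * (a j - 1 / 3)) * v j l) f := by
    simp [P, polynomial_eval_aeval, Polynomial.eval_finsetSum]
  have hP0 : P = 0 := by
    apply Polynomial.eq_zero_of_infinite_isRoot
    apply infinite_of_mem_nhds (0 : ℝ)
    have hev : ∀ᶠ s : ℝ in nhds 0, ∀ j, 0 < 1 / 3 + s * (a j - 1 / 3) := by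
      rw [Filter.eventually_all]
      intro j
      refine ContinuousAt.eventually_lt (f := fun _ => (0 : ℝ)) continuousAt_const
        (by fun_prop) (by norm_num)
    filter_upwards [hev] with s hs
    rw [Polynomial.IsRoot, hP]
    apply hf
    have hcard : ∑ j ∈ univ.erase i, (1 / 3 + s * (a j - 1 / 3)) = 1 := by
      rw [sum_add_distrib, ← mul_sum, sum_sub_distrib, hsum]
      simp
    have := (convex_convexHull ℝ (v '' {j | j ≠ i})).sum_mem (t := univ.erase i)
      (w := fun j => 1 / 3 + s * (a j - 1 / 3)) (z := v) (fun j _ => (hs j).le) hcard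
      fun j hj => subset_convexHull ℝ _ ⟨j, (mem_erase.1 hj).1, rfl⟩
    convert this using 1
    ext l
    simp
  have := hP 1
  rw [hP0, Polynomial.eval_zero] at this
  rw [this]
  congr 2
  ext l
  rw [← hxv l]
  exact sum_congr rfl fun j _ => by ring

theorem eval_affPoly_face (h : IsBarycentric v m c) (i : Fin 4) {x : Fin 3 → ℝ}
    (hx : x ∈ convexHull ℝ (v '' {j | j ≠ i})) : eval x (affPoly (c i) (m i)) = 0 := by
  refine convexHull_min (t := {x | eval x (affPoly (c i) (m i)) = 0}) ?_ ?_ hx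
  · rintro _ ⟨j, hj, rfl⟩
    simp [eval_affPoly, h.eval_vertex, Ne.symm hj]
  · intro x hx y hy a b _ _ hab
    simp only [Set.mem_ofPred_eq, eval_affPoly] at *
    have : ∑ l, m i l * (a • x + b • y) l =
        a * ∑ l, m i l * x l + b * ∑ l, m i l * y l := by
      simp only [mul_sum, ← sum_add_distrib]
      exact sum_congr rfl fun l _ => by simp; ring
    rw [this]
    linear_combination a * hx + b * hy - c i * hab

end IsBarycentric

theorem normalEvalL_apply (ν x : Fin 3 → ℝ) (z : Fin 3 → MvPolynomial (Fin 3) ℝ) :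
    normalEvalL ν x z = eval x (∑ l, C (ν l) * z l) := by
  simp [normalEvalL, aeval_eq_eval]

theorem divL_apply (z : Fin 3 → MvPolynomial (Fin 3) ℝ) : divL z = ∑ i, pderiv i (z i) := by
  simp [divL]

theorem IsBarycentric.mem_Zspace_iff {v m : Fin 4 → Fin 3 → ℝ} {c : Fin 4 → ℝ}
    (h : IsBarycentric v m c) {k : ℕ} {z : Fin 3 → MvPolynomial (Fin 3) ℝ} :
    z ∈ Zspace k v m ↔ (∀ l, z l ∈ polyLT (k + 1)) ∧ divL z = 0 ∧
      ∀ i, affPoly (c i) (m i) ∣ ∑ l, C (m i l) * z l := by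
  simp only [Zspace, Submodule.mem_inf, Submodule.mem_pi, Set.mem_univ, true_imp_iff,
    mem_restrictTotalDegree, LinearMap.mem_ker, Submodule.mem_iInf, normalEvalL_apply, and_assoc,
    mem_polyLT_succ_iff]
  refine and_congr_right fun _ => and_congr_right fun _ => forall_congr' fun i =>
    ⟨h.affPoly_dvd_of_eval_face i, ?_⟩
  rintro ⟨g, hg⟩ x hx
  rw [hg, map_mul, h.eval_affPoly_face i hx, zero_mul]

/-- monomials in the affine functions `c i + m i · x` -/
noncomputable def affMonomial (c : Fin 4 → ℝ) (m : Fin 4 → Fin 3 → ℝ) (a : Fin 4 → ℕ) :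
    MvPolynomial (Fin 3) ℝ :=
  ∏ l, affPoly (c l) (m l) ^ a l

theorem affMonomial_add_single (c : Fin 4 → ℝ) (m : Fin 4 → Fin 3 → ℝ) (a : Fin 4 → ℕ)
    (i : Fin 4) :
    affMonomial c m (a + Pi.single i 1) = affPoly (c i) (m i) * affMonomial c m a := by
  rw [affMonomial, affMonomial, ← mul_prod_erase _ _ (mem_univ i),
    ← mul_prod_erase _ (fun l => affPoly (c l) (m l) ^ a l) (mem_univ i), ← mul_assoc]
  congr 1
  · simp [pow_succ']
  · exact prod_congr rfl fun l hl => by simp [(mem_erase.1 hl).1]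

theorem affMonomial_mem_polyLT (c : Fin 4 → ℝ) (m : Fin 4 → Fin 3 → ℝ) (a : Fin 4 → ℕ) :
    affMonomial c m a ∈ polyLT (∑ i, a i + 1) := by
  rw [mem_polyLT_succ_iff]
  refine (totalDegree_finsetProd _ _).trans (sum_le_sum fun i _ => ?_)
  refine (totalDegree_pow _ _).trans ?_
  simpa using Nat.mul_le_mul_left (a i) (mem_polyLT_succ_iff.1 (affPoly_mem_polyLT (c i) (m i)))

theorem exists_eq_add_single {a : Fin 4 → ℕ} {i : Fin 4} (h : a i ≠ 0) :
    ∃ b : Fin 4 → ℕ, a = b + Pi.single i 1 := by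
  refine ⟨a - Pi.single i 1, (tsub_add_cancel_of_le fun j => ?_).symm⟩
  rcases eq_or_ne j i with rfl | hj
  · simpa [Nat.one_le_iff_ne_zero] using h
  · simp [hj]

theorem sum_add_single (a : Fin 4 → ℕ) (i : Fin 4) :
    ∑ j, (a + Pi.single i 1 : Fin 4 → ℕ) j = ∑ j, a j + 1 := by
  simp [sum_add_distrib]

theorem span_range_affPoly_pow_le (c : Fin 4 → ℝ) (m : Fin 4 → Fin 3 → ℝ) (d : ℕ) :
    Submodule.span ℝ (Set.range fun i => affPoly (c i) (m i)) ^ d ≤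
      Submodule.span ℝ (affMonomial c m '' {a | ∑ i, a i = d}) := by
  induction d with
  | zero =>
    rw [pow_zero, Submodule.one_le]
    exact Submodule.subset_span ⟨0, by simp, by simp [affMonomial]⟩
  | succ d ih =>
    rw [pow_succ']
    refine (mul_le_mul_right ih _).trans ?_
    rw [Submodule.span_mul_span]
    refine Submodule.span_mono ?_
    rintro _ ⟨_, ⟨i, rfl⟩, _, ⟨a, ha, rfl⟩, rfl⟩
    exact ⟨a + Pi.single i 1, by simpa [sum_add_distrib] using ha, affMonomial_add_single c m a i⟩

theorem Derivation.leibniz_finsetProd {ι R A : Type*} [DecidableEq ι] [CommSemiring R]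
    [CommSemiring A] [Algebra R A] (D : Derivation R A A) (s : Finset ι) (f : ι → A) :
    D (∏ i ∈ s, f i) = ∑ i ∈ s, (∏ j ∈ s.erase i, f j) * D (f i) := by
  induction s using Finset.induction_on with
  | empty => simp
  | insert a s ha ih =>
    rw [prod_insert ha, Derivation.leibniz, ih, sum_insert ha, erase_insert ha, smul_eq_mul,
      smul_eq_mul, add_comm, mul_sum]
    congr 1
    refine sum_congr rfl fun i hi => ?_
    rw [erase_insert_of_ne (ne_of_mem_of_not_mem hi ha).symm,
      prod_insert fun h => ha (mem_of_mem_erase h), mul_assoc]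

/-- the field `∑ i, μ i * w i * v i`, whose `i`-th barycentric component is `μ i * w i`
if `∑ i, μ i * w i = 0` -/
noncomputable def bubbleField (v m : Fin 4 → Fin 3 → ℝ) (c : Fin 4 → ℝ) :
    (Fin 4 → MvPolynomial (Fin 3) ℝ) →ₗ[ℝ] (Fin 3 → MvPolynomial (Fin 3) ℝ) :=
  LinearMap.pi fun l => ∑ i,
    (LinearMap.mulLeft ℝ (C (v i l) * affPoly (c i) (m i))).comp (LinearMap.proj i)

theorem bubbleField_apply (v m : Fin 4 → Fin 3 → ℝ) (c : Fin 4 → ℝ)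
    (w : Fin 4 → MvPolynomial (Fin 3) ℝ) (l : Fin 3) :
    bubbleField v m c w l = ∑ i, C (v i l) * (affPoly (c i) (m i) * w i) := by
  simp [bubbleField]

theorem divL_bubbleField (v m : Fin 4 → Fin 3 → ℝ) (c : Fin 4 → ℝ)
    (w : Fin 4 → MvPolynomial (Fin 3) ℝ) :
    divL (bubbleField v m c w) = ∑ i, dirDeriv (v i) (affPoly (c i) (m i) * w i) := by
  simp only [divL_apply, bubbleField_apply, map_sum, pderiv_C_mul, dirDeriv_apply]
  exact sum_comm

/-- the linear map `w ↦ (∑ i, μ i * w i, div (∑ i, μ i * w i * v i))` -/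
noncomputable def sumDivL (v m : Fin 4 → Fin 3 → ℝ) (c : Fin 4 → ℝ) :
    (Fin 4 → MvPolynomial (Fin 3) ℝ) →ₗ[ℝ] MvPolynomial (Fin 3) ℝ × MvPolynomial (Fin 3) ℝ :=
  LinearMap.prod (∑ i, (LinearMap.mulLeft ℝ (affPoly (c i) (m i))).comp (LinearMap.proj i))
    (divL.comp (bubbleField v m c))

theorem sumDivL_apply (v m : Fin 4 → Fin 3 → ℝ) (c : Fin 4 → ℝ)
    (w : Fin 4 → MvPolynomial (Fin 3) ℝ) :
    sumDivL v m c w = (∑ i, affPoly (c i) (m i) * w i,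
      ∑ i, dirDeriv (v i) (affPoly (c i) (m i) * w i)) := by
  simp [sumDivL, divL_bubbleField]

/-- `sumDivL` restricted to fields of degree `< d` -/
noncomputable def sumDivLT (v m : Fin 4 → Fin 3 → ℝ) (c : Fin 4 → ℝ) (d : ℕ) :
    (Fin 4 → polyLT d) →ₗ[ℝ] MvPolynomial (Fin 3) ℝ × MvPolynomial (Fin 3) ℝ :=
  (sumDivL v m c).comp ((polyLT d).subtype.compLeft (Fin 4))

theorem sumDivL_mem_range {v m : Fin 4 → Fin 3 → ℝ} {c : Fin 4 → ℝ} {d : ℕ}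
    {w : Fin 4 → MvPolynomial (Fin 3) ℝ} (hw : ∀ i, w i ∈ polyLT d) : sumDivL v m c w ∈ LinearMap.range (sumDivLT v m c d) :=
  ⟨fun i => ⟨w i, hw i⟩, rfl⟩

namespace IsBarycentric

variable {v m : Fin 4 → Fin 3 → ℝ} {c : Fin 4 → ℝ}

theorem polyLT_le_span (h : IsBarycentric v m c) (d : ℕ) :
    polyLT (d + 1) ≤ Submodule.span ℝ (affMonomial c m '' {a | ∑ i, a i = d}) := by
  refine le_trans ?_ (span_range_affPoly_pow_le c m d)
  set L := Submodule.span ℝ (Set.range fun i => affPoly (c i) (m i)) with hL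
  have hmem (i : Fin 4) : affPoly (c i) (m i) ∈ L := Submodule.subset_span ⟨i, rfl⟩
  have h1 : 1 ∈ L := h.sum_affPoly ▸ sum_mem fun i _ => hmem i
  have hX (l : Fin 3) : X l ∈ L := by
    rw [← h.sum_mul_affPoly l]
    exact sum_mem fun i _ => by
      rw [C_mul']
      exact L.smul_mem _ (hmem i)
  rw [polyLT, restrictSupport_eq_span, Submodule.span_le]
  rintro _ ⟨a, ha, rfl⟩
  obtain ⟨e, rfl⟩ : ∃ e, d = a 0 + a 1 + a 2 + e := by
    refine ⟨d - (a 0 + a 1 + a 2), ?_⟩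
    simp only [Set.mem_ofPred_eq, Finsupp.degree_eq_sum, Fin.sum_univ_three] at ha
    omega
  have : (monomial a 1 : MvPolynomial (Fin 3) ℝ) =
      X 0 ^ a 0 * X 1 ^ a 1 * X 2 ^ a 2 * 1 ^ e := by
    rw [monomial_eq, Finsupp.prod_fintype _ _ (by simp), Fin.prod_univ_three]
    simp
  simp only [this, pow_add, SetLike.mem_coe]
  exact Submodule.mul_mem_mul (Submodule.mul_mem_mul (Submodule.mul_mem_mul
    (Submodule.pow_mem_pow _ (hX 0) _) (Submodule.pow_mem_pow _ (hX 1) _))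
    (Submodule.pow_mem_pow _ (hX 2) _)) (Submodule.pow_mem_pow _ h1 _)

theorem dirDeriv_sub_affMonomial (h : IsBarycentric v m c) {i j : Fin 4} (hij : i ≠ j)
    (a : Fin 4 → ℕ) :
    dirDeriv (v i) (affMonomial c m (a + Pi.single i 1 + Pi.single j 1)) -
      dirDeriv (v j) (affMonomial c m (a + Pi.single i 1 + Pi.single j 1)) =
    (a i + 1) * affMonomial c m (a + Pi.single j 1) -
      (a j + 1) * affMonomial c m (a + Pi.single i 1) := by
  rw [← Derivation.sub_apply]
  set D := dirDeriv (v i) - dirDeriv (v j) with hD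
  have hDl (l : Fin 4) : D (affPoly (c l) (m l)) =
      C ((if l = i then 1 else 0) - (if l = j then 1 else 0)) := by
    rw [hD, Derivation.sub_apply, dirDeriv_affPoly, dirDeriv_affPoly, ← C_sub,
      ← h.eval_vertex l i, ← h.eval_vertex l j]
    ring_nf
  have hi : D (affPoly (c i) (m i)) = 1 := by simp [hDl, hij]
  have hj : D (affPoly (c j) (m j)) = -1 := by simp [hDl, hij.symm]
  have hQ : D (∏ l ∈ (univ.erase i).erase j, affPoly (c l) (m l) ^ a l) = 0 := by
    rw [D.leibniz_finsetProd]
    refine sum_eq_zero fun l hl => ?_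
    simp only [mem_erase] at hl
    rw [Derivation.leibniz_pow, hDl]
    simp [hl.1, hl.2.1]
  have hM : affMonomial c m a = affPoly (c i) (m i) ^ a i * (affPoly (c j) (m j) ^ a j *
      ∏ l ∈ (univ.erase i).erase j, affPoly (c l) (m l) ^ a l) := by
    rw [mul_prod_erase _ (fun l => affPoly (c l) (m l) ^ a l)
      (mem_erase.2 ⟨hij.symm, mem_univ j⟩),
      mul_prod_erase _ (fun l => affPoly (c l) (m l) ^ a l) (mem_univ i), affMonomial]
  simp only [affMonomial_add_single, hM]
  set x := affPoly (c i) (m i)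
  set y := affPoly (c j) (m j)
  set Q := ∏ l ∈ (univ.erase i).erase j, affPoly (c l) (m l) ^ a l
  have : y * (x * (x ^ a i * (y ^ a j * Q))) = x ^ (a i + 1) * y ^ (a j + 1) * Q := by ring
  rw [this, Derivation.leibniz, Derivation.leibniz, Derivation.leibniz_pow,
    Derivation.leibniz_pow, hQ, hi, hj]
  simp only [smul_eq_mul, nsmul_eq_mul, add_tsub_cancel_right]
  push_cast
  ring

theorem affMonomial_mem_range_sup (h : IsBarycentric v m c) {d : ℕ} (n : ℕ) (a : Fin 4 → ℕ)
    (ha : ∑ i, a i = d) (hn : a 0 + n = d) :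
    ((0, affMonomial c m a) : MvPolynomial (Fin 3) ℝ × MvPolynomial (Fin 3) ℝ) ∈
      LinearMap.range (sumDivLT v m c (d + 1)) ⊔
        Submodule.span ℝ {(0, affMonomial c m (Pi.single 0 d))} := by
  induction n generalizing a with
  | zero =>
    have : a = Pi.single 0 d := by
      rw [Fin.sum_univ_four] at ha
      ext i
      fin_cases i <;> simp <;> omega
    rw [this]
    exact Submodule.mem_sup_right (Submodule.mem_span_singleton_self _)
  | succ n ih =>
    obtain ⟨j, hj, haj⟩ : ∃ j, j ≠ 0 ∧ a j ≠ 0 := by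
      by_contra! hcon
      rw [Fin.sum_univ_four, hcon 1 (by decide), hcon 2 (by decide), hcon 3 (by decide)] at ha
      omega
    obtain ⟨b, rfl⟩ := exists_eq_add_single haj
    have hb : ∑ i, b i + 1 = d := by rw [← ha, sum_add_single]
    have hb0 : b 0 + (n + 1) = d := by simpa [hj.symm] using hn
    have h0 := ih (b + Pi.single 0 1) (by rw [sum_add_single, hb]) (by simp; omega)
    have hmem (i : Fin 4) : affMonomial c m (b + Pi.single i 1) ∈ polyLT (d + 1) := by
      have := affMonomial_mem_polyLT c m (b + Pi.single i 1)
      rwa [sum_add_single, hb] at this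
    have hr := sumDivL_mem_range (v := v) (m := m) (c := c) (d := d + 1)
      (w := Pi.single 0 (affMonomial c m (b + Pi.single j 1)) -
        Pi.single j (affMonomial c m (b + Pi.single 0 1))) fun i => by
      refine sub_mem ?_ ?_ <;> rw [Pi.single_apply] <;> split_ifs
      exacts [hmem j, zero_mem _, hmem 0, zero_mem _]
    have hw : sumDivL v m c (Pi.single 0 (affMonomial c m (b + Pi.single j 1)) -
        Pi.single j (affMonomial c m (b + Pi.single 0 1))) =
        (0, (b 0 + 1) * affMonomial c m (b + Pi.single j 1) -
          (b j + 1) * affMonomial c m (b + Pi.single 0 1)) := by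
      have hs (i : Fin 4) (f : MvPolynomial (Fin 3) ℝ) : sumDivL v m c (Pi.single i f) =
          (affPoly (c i) (m i) * f, dirDeriv (v i) (affPoly (c i) (m i) * f)) := by
        rw [sumDivL_apply, Finset.sum_eq_single i, Finset.sum_eq_single i]
        all_goals simp +contextual
      rw [map_sub, hs, hs, ← h.dirDeriv_sub_affMonomial hj.symm b, Prod.mk_sub_mk,
        ← affMonomial_add_single, ← affMonomial_add_single,
        add_right_comm b (Pi.single 0 1) (Pi.single j 1), sub_self]
    rw [hw] at hr
    have hne : ((b 0 : ℝ) + 1) ≠ 0 := by positivity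
    have := Submodule.smul_mem _ ((b 0 : ℝ) + 1)⁻¹ (add_mem (Submodule.mem_sup_left hr)
      (Submodule.smul_mem _ ((b j : ℝ) + 1) h0))
    convert this using 1
    have hn (n : ℕ) : ((n : MvPolynomial (Fin 3) ℝ) + 1) = C ((n : ℝ) + 1) := by simp
    rw [hn, hn, Prod.smul_mk, Prod.mk_add_mk, Prod.smul_mk, C_mul', C_mul', sub_add_cancel,
      inv_smul_smul₀ hne]
    simp

theorem prod_le_range_sup (h : IsBarycentric v m c) (d : ℕ) :
    (polyLT (d + 2)).prod (polyLT (d + 1)) ≤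
      LinearMap.range (sumDivLT v m c (d + 1)) ⊔
        Submodule.span ℝ {(0, affMonomial c m (Pi.single 0 d))} := by
  rintro ⟨f, g⟩ ⟨hf, hg⟩
  set U := LinearMap.range (sumDivLT v m c (d + 1)) ⊔
    Submodule.span ℝ {(0, affMonomial c m (Pi.single 0 d))} with hU
  have h2 (g) (hg : g ∈ polyLT (d + 1)) :
      ((0, g) : MvPolynomial (Fin 3) ℝ × MvPolynomial (Fin 3) ℝ) ∈ U := by
    have : polyLT (d + 1) ≤ U.comap (LinearMap.inr ℝ _ _) := by
      refine (h.polyLT_le_span d).trans (Submodule.span_le.2 ?_)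
      rintro _ ⟨a, ha, rfl⟩
      have ha0 : a 0 ≤ d := ha ▸ single_le_sum (f := a) (fun _ _ => Nat.zero_le _) (mem_univ 0)
      exact h.affMonomial_mem_range_sup (d - a 0) a ha (by omega)
    exact this hg
  obtain ⟨w, hw, hwf⟩ : ∃ w : Fin 4 → MvPolynomial (Fin 3) ℝ, (∀ i, w i ∈ polyLT (d + 1)) ∧
      ∑ i, affPoly (c i) (m i) * w i = f := by
    have : polyLT (d + 2) ≤ (Submodule.pi Set.univ fun _ : Fin 4 => polyLT (d + 1)).map
        (∑ i, (LinearMap.mulLeft ℝ (affPoly (c i) (m i))).comp (LinearMap.proj i)) := by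
      refine (h.polyLT_le_span (d + 1)).trans (Submodule.span_le.2 ?_)
      rintro _ ⟨a, ha, rfl⟩
      obtain ⟨i, hi⟩ : ∃ i, a i ≠ 0 := by
        by_contra! hcon
        simp [hcon] at ha
      obtain ⟨b, rfl⟩ := exists_eq_add_single hi
      have hb : ∑ i, b i = d := by simpa [sum_add_distrib] using ha
      refine ⟨Pi.single i (affMonomial c m b), fun j _ => ?_, ?_⟩
      · rw [Pi.single_apply]
        split_ifs
        exacts [hb ▸ affMonomial_mem_polyLT c m b, zero_mem _]
      · rw [affMonomial_add_single, LinearMap.sum_apply, Finset.sum_eq_single i]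
        all_goals simp +contextual
    obtain ⟨w, hw, hwf⟩ := this hf
    exact ⟨w, fun i => hw i trivial, by simpa using hwf⟩
  have hwd : ∑ i, dirDeriv (v i) (affPoly (c i) (m i) * w i) ∈ polyLT (d + 1) :=
    sum_mem fun i _ => by
      rw [dirDeriv_apply]
      refine sum_mem fun l _ => ?_
      rw [C_mul']
      refine Submodule.smul_mem _ _ (pderiv_mem_polyLT ?_ l)
      rw [add_comm]
      exact mul_mem_polyLT (affPoly_mem_polyLT _ _) (hw i)
  have h1 : sumDivL v m c w ∈ U := Submodule.mem_sup_left (sumDivL_mem_range hw)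
  convert add_mem h1 (h2 _ (sub_mem hg hwd)) using 1
  simp [sumDivL_apply, hwf]

theorem finrank_ker_sumDivLT_add_le (h : IsBarycentric v m c) (d : ℕ) :
    Module.finrank ℝ (LinearMap.ker (sumDivLT v m c (d + 1))) + (d + 4).choose 3 ≤
      3 * (d + 3).choose 3 + 1 := by
  have h1 := LinearMap.finrank_range_add_finrank_ker (sumDivLT v m c (d + 1))
  have h2 := Submodule.finrank_mono (h.prod_le_range_sup d)
  have h3 := Submodule.finrank_add_le_finrank_add_finrank
    (LinearMap.range (sumDivLT v m c (d + 1)))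
    (Submodule.span ℝ {(0, affMonomial c m (Pi.single 0 d))})
  have h4 := finrank_span_le_card (R := ℝ)
    {((0, affMonomial c m (Pi.single 0 d)) : MvPolynomial (Fin 3) ℝ × MvPolynomial (Fin 3) ℝ)}
  rw [Set.toFinset_singleton, card_singleton] at h4
  have h5 : LinearMap.range ((polyLT (d + 2)).subtype.prodMap (polyLT (d + 1)).subtype) =
      (polyLT (d + 2)).prod (polyLT (d + 1)) := by
    simp [LinearMap.range_prodMap]
  rw [← h5, LinearMap.finrank_range_of_inj (Function.Injective.prodMap
    (Submodule.injective_subtype _) (Submodule.injective_subtype _)), Module.finrank_prod,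
    finrank_polyLT, finrank_polyLT] at h2
  rw [Module.finrank_pi_fintype] at h1
  simp only [finrank_polyLT, Finset.sum_const, card_univ, Fintype.card_fin, smul_eq_mul] at h1
  simp only [add_assoc, Nat.reduceAdd] at *
  omega

theorem finrank_Zspace_add_le (h : IsBarycentric v m c) (d : ℕ) :
    Module.finrank ℝ (Zspace (d + 1) v m) + (d + 4).choose 3 ≤ 3 * (d + 3).choose 3 + 1 := by
  refine le_trans (Nat.add_le_add_right ?_ _) (h.finrank_ker_sumDivLT_add_le d)
  refine le_trans (Submodule.finrank_mono (t := (LinearMap.ker (sumDivLT v m c (d + 1))).map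
    ((bubbleField v m c).comp ((polyLT (d + 1)).subtype.compLeft (Fin 4)))) ?_)
    (Submodule.finrank_map_le _ _)
  intro z hz
  obtain ⟨hdeg, hdiv, hdvd⟩ := h.mem_Zspace_iff.1 hz
  choose w hw using hdvd
  have hwd (i : Fin 4) : w i ∈ polyLT (d + 1) := by
    obtain ⟨t, ht⟩ := h.exists_transversal i
    refine mem_polyLT_of_mul_mem (totalDegree_affPoly (c := c i) ht) ?_
    rw [← hw i]
    exact sum_mem fun l _ => by
      rw [C_mul']
      exact Submodule.smul_mem _ _ (hdeg l)
  have hz : bubbleField v m c w = z := by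
    ext1 l
    simp only [bubbleField_apply, ← hw, h.sum_mul_dot]
  refine ⟨fun i => ⟨w i, hwd i⟩, ?_, hz⟩
  change sumDivL v m c w = 0
  rw [sumDivL_apply, ← divL_bubbleField, hz, hdiv]
  simp only [← hw, h.sum_dot]
  rfl

end IsBarycentric

theorem pderiv_pderiv_comm {σ R : Type*} [CommRing R] (i j : σ) (f : MvPolynomial σ R) :
    pderiv i (pderiv j f) = pderiv j (pderiv i f) := by
  classical
  have : ⁅pderiv (R := R) i, pderiv (R := R) j⁆ = 0 :=
    MvPolynomial.derivation_ext fun l => by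
      simp [Derivation.commutator_apply, pderiv_X, Pi.single_apply, apply_ite]
  have h := congrArg (fun D => D f) this
  simpa [Derivation.commutator_apply, sub_eq_zero] using h

theorem curlL_apply_zero (w : Fin 3 → MvPolynomial (Fin 3) ℝ) :
    curlL w 0 = pderiv 1 (w 2) - pderiv 2 (w 1) := by
  simp [curlL]

theorem curlL_apply_one (w : Fin 3 → MvPolynomial (Fin 3) ℝ) :
    curlL w 1 = pderiv 2 (w 0) - pderiv 0 (w 2) := by
  simp [curlL]

theorem curlL_apply_two (w : Fin 3 → MvPolynomial (Fin 3) ℝ) :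
    curlL w 2 = pderiv 0 (w 1) - pderiv 1 (w 0) := by
  simp [curlL]

theorem divL_curlL (w : Fin 3 → MvPolynomial (Fin 3) ℝ) : divL (curlL w) = 0 := by
  simp only [divL_apply, Fin.sum_univ_three, curlL_apply_zero, curlL_apply_one, curlL_apply_two,
    map_sub]
  rw [pderiv_pderiv_comm 1 0, pderiv_pderiv_comm 2 0, pderiv_pderiv_comm 2 1]
  ring

theorem exists_potential_of_curlL_eq_zero {w : Fin 3 → MvPolynomial (Fin 3) ℝ}
    (hw : curlL w = 0) : ∃ φ, ∀ i, pderiv i φ = w i := by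
  have h0 := congrFun hw 0
  have h1 := congrFun hw 1
  have h2 := congrFun hw 2
  rw [curlL_apply_zero, Pi.zero_apply, sub_eq_zero] at h0
  rw [curlL_apply_one, Pi.zero_apply, sub_eq_zero] at h1
  rw [curlL_apply_two, Pi.zero_apply, sub_eq_zero] at h2
  refine exists_potential w fun i j => ?_
  fin_cases i <;> fin_cases j
  exacts [rfl, h2, h1.symm, h2.symm, rfl, h0, h1, h0.symm, rfl]

theorem curlL_mem_polyLT {w : Fin 3 → MvPolynomial (Fin 3) ℝ} {d : ℕ}
    (hw : ∀ l, w l ∈ polyLT (d + 1)) (l : Fin 3) : curlL w l ∈ polyLT d := by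
  have h (i j : Fin 3) : pderiv i (w j) ∈ polyLT d := pderiv_mem_polyLT (hw j) i
  fin_cases l
  · exact curlL_apply_zero w ▸ sub_mem (h _ _) (h _ _)
  · exact curlL_apply_one w ▸ sub_mem (h _ _) (h _ _)
  · exact curlL_apply_two w ▸ sub_mem (h _ _) (h _ _)

theorem affPoly_dvd_dot_curlL {c : ℝ} {m ν : Fin 3 → ℝ} {g : MvPolynomial (Fin 3) ℝ}
    (h : affPoly c m ∣ g ∨ ν = m) :
    affPoly c m ∣ ∑ l, C (m l) * curlL (fun l => C (ν l) * g) l := by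
  rcases h with ⟨g, rfl⟩ | rfl
  · refine ⟨∑ l, C (m l) * curlL (fun l => C (ν l) * g) l, ?_⟩
    simp only [Fin.sum_univ_three, curlL_apply_zero, curlL_apply_one, curlL_apply_two,
      pderiv_mul, pderiv_affPoly, pderiv_C]
    ring
  · convert dvd_zero _
    simp only [Fin.sum_univ_three, curlL_apply_zero, curlL_apply_one, curlL_apply_two,
      pderiv_C_mul]
    ring

theorem prod_affPoly_mem_polyLT (c : Fin 4 → ℝ) (m : Fin 4 → Fin 3 → ℝ) (s : Finset (Fin 4)) :
    ∏ j ∈ s, affPoly (c j) (m j) ∈ polyLT (s.card + 1) := by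
  rw [mem_polyLT_succ_iff]
  refine (totalDegree_finsetProd _ _).trans ?_
  simpa using sum_le_card_nsmul s _ 1 fun i _ =>
    mem_polyLT_succ_iff.1 (affPoly_mem_polyLT (c i) (m i))

/-- the sum of the cup fields with polynomial weights `p i` -/
noncomputable def cupL (m : Fin 4 → Fin 3 → ℝ) (c : Fin 4 → ℝ) :
    (Fin 4 → MvPolynomial (Fin 3) ℝ) →ₗ[ℝ] (Fin 3 → MvPolynomial (Fin 3) ℝ) :=
  LinearMap.pi fun l => ∑ i, (LinearMap.mulLeft ℝ
    (C (m i l) * ∏ j ∈ univ.erase i, affPoly (c j) (m j))).comp (LinearMap.proj i)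

theorem cupL_apply (m : Fin 4 → Fin 3 → ℝ) (c : Fin 4 → ℝ)
    (p : Fin 4 → MvPolynomial (Fin 3) ℝ) (l : Fin 3) :
    cupL m c p l = ∑ i, C (m i l) * ((∏ j ∈ univ.erase i, affPoly (c j) (m j)) * p i) := by
  simp [cupL]

theorem cup_mem_polyLT {t : ℕ} {p : MvPolynomial (Fin 3) ℝ} (hp : p ∈ polyLT (t + 1))
    (m : Fin 4 → Fin 3 → ℝ) (c : Fin 4 → ℝ) (i : Fin 4) (r : ℝ) :
    C r * ((∏ j ∈ univ.erase i, affPoly (c j) (m j)) * p) ∈ polyLT (t + 4) := by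
  have := mul_mem_polyLT (prod_affPoly_mem_polyLT c m (univ.erase i)) hp
  rw [C_mul']
  refine Submodule.smul_mem _ _ ?_
  convert this using 2
  simp
  ring

/-- `r + μ i * ∂_{v i} r + μ i * s`; these are the weights of the gradient cup fields -/
noncomputable def gradWeightL (v m : Fin 4 → Fin 3 → ℝ) (c : Fin 4 → ℝ) :
    MvPolynomial (Fin 3) ℝ × MvPolynomial (Fin 3) ℝ →ₗ[ℝ] (Fin 4 → MvPolynomial (Fin 3) ℝ) :=
  LinearMap.pi fun i => LinearMap.coprod
    (LinearMap.id + (LinearMap.mulLeft ℝ (affPoly (c i) (m i))).comp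
      (dirDeriv (v i)).toLinearMap)
    (LinearMap.mulLeft ℝ (affPoly (c i) (m i)))

theorem gradWeightL_apply (v m : Fin 4 → Fin 3 → ℝ) (c : Fin 4 → ℝ)
    (r s : MvPolynomial (Fin 3) ℝ) (i : Fin 4) :
    gradWeightL v m c (r, s) i =
      r + affPoly (c i) (m i) * dirDeriv (v i) r + affPoly (c i) (m i) * s := by
  simp [gradWeightL]

theorem six_mul_choose_three (n : ℕ) : 6 * (n + 2).choose 3 = n * (n + 1) * (n + 2) := by
  induction n with
  | zero => rfl
  | succ n ih =>
    have h2 : (n + 2).choose 2 * 2 = (n + 2) * (n + 1) := by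
      rw [Nat.choose_two_right, Nat.div_mul_cancel (Nat.even_mul_pred_self _).two_dvd]
      rfl
    rw [Nat.choose_succ_succ' (n + 2) 2]
    linarith

theorem pi3_natCast_sub_one (n : ℕ) : pi3 ((n : ℤ) - 1) = (n + 2).choose 3 := by
  have h : ((n : ℤ) - 1 + 1) * ((n : ℤ) - 1 + 2) * ((n : ℤ) - 1 + 3) =
      6 * ((n + 2).choose 3 : ℕ) := by
    have := six_mul_choose_three n
    zify at this
    rw [this]
    ring
  rw [pi3, h]
  split_ifs with h0
  · exact Int.mul_ediv_cancel_left _ (by norm_num)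
  · obtain rfl : n = 0 := by omega
    rfl

namespace IsBarycentric

variable {v m : Fin 4 → Fin 3 → ℝ} {c : Fin 4 → ℝ}

theorem curlL_Cspace_le (h : IsBarycentric v m c) (t : ℕ) :
    (Cspace (t + 3) m fun i => affPoly (c i) (m i)).map curlL ≤ Zspace (t + 2) v m := by
  rw [Cspace, Submodule.map_span, Submodule.span_le]
  rintro _ ⟨_, ⟨i, p, hp, rfl⟩, rfl⟩
  refine h.mem_Zspace_iff.2 ⟨?_, divL_curlL _, fun j => affPoly_dvd_dot_curlL ?_⟩
  · exact curlL_mem_polyLT fun l => cup_mem_polyLT (mem_polyLT_succ_iff.2 hp) m c i _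
  · rcases eq_or_ne i j with rfl | hij
    · exact Or.inr rfl
    · exact Or.inl (dvd_mul_of_dvd_left
        (dvd_prod_of_mem (fun j => affPoly (c j) (m j)) (by simp [hij.symm])) p)

theorem eval_vertex_affPoly (h : IsBarycentric v m c) (i j : Fin 4) :
    eval (v j) (affPoly (c i) (m i)) = if i = j then 1 else 0 := by
  rw [eval_affPoly, h.eval_vertex]

theorem prod_affPoly_dvd (h : IsBarycentric v m c) {f : MvPolynomial (Fin 3) ℝ}
    (hf : ∀ i, affPoly (c i) (m i) ∣ f) : ∏ i, affPoly (c i) (m i) ∣ f := by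
  refine Fintype.prod_dvd_of_isRelPrime (fun i j hij => ?_) hf
  obtain ⟨t, ht⟩ := h.exists_transversal i
  refine ((prime_affPoly ht).irreducible.isRelPrime_iff_not_dvd).2 fun hdvd => ?_
  have := (map_dvd (eval (v j)) hdvd)
  simp [h.eval_vertex_affPoly, hij] at this

theorem mem_polyLT_of_prod_mul_mem (h : IsBarycentric v m c) (s : Finset (Fin 4)) {d : ℕ}
    {f : MvPolynomial (Fin 3) ℝ}
    (hf : (∏ i ∈ s, affPoly (c i) (m i)) * f ∈ polyLT (d + s.card)) : f ∈ polyLT d := by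
  induction s using Finset.induction_on with
  | empty => simpa using hf
  | insert a s ha ih =>
    obtain ⟨t, ht⟩ := h.exists_transversal a
    rw [prod_insert ha, mul_assoc, card_insert_of_notMem ha, ← add_assoc] at hf
    exact ih (mem_polyLT_of_mul_mem (totalDegree_affPoly ht) hf)

theorem eq_of_sum_C_mul_eq_zero (h : IsBarycentric v m c) {f : Fin 4 → MvPolynomial (Fin 3) ℝ}
    (hf : ∀ l, ∑ i, C (m i l) * f i = 0) (j : Fin 4) : f j = ∑ i, C (c i) * f i := by
  have h1 : ∑ l, C (v j l) * ∑ i, C (m i l) * f i = 0 := by simp [hf]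
  simp only [mul_sum, ← mul_assoc, ← C_mul] at h1
  rw [sum_comm] at h1
  simp only [← sum_mul, ← map_sum] at h1
  have h2 (i : Fin 4) : ∑ l, v j l * m i l = (if i = j then 1 else 0) - c i := by
    rw [← h.eval_vertex i j, add_sub_cancel_left]
    exact sum_congr rfl fun l _ => mul_comm _ _
  simp only [h2, C_sub, sub_mul, sum_sub_distrib] at h1
  rw [sub_eq_zero] at h1
  rw [← h1]
  simp [apply_ite]

theorem exists_eq_prod_mul_of_pderiv_eq_cupL (h : IsBarycentric v m c)
    {φ : MvPolynomial (Fin 3) ℝ} {p : Fin 4 → MvPolynomial (Fin 3) ℝ}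
    (hφ : ∀ l, pderiv l φ = cupL m c p l) :
    ∃ a r, φ = C a + (∏ i, affPoly (c i) (m i)) * r := by
  have hr (i : Fin 4) : ∃ r, affPoly (c i) (m i) ∣ φ - C r := by
    obtain ⟨t, ht⟩ := h.exists_transversal i
    refine exists_affPoly_dvd_sub_C (g := (∏ j ∈ univ.erase i, affPoly (c j) (m j)) * p i) ht
      fun l => ?_
    rw [hφ, cupL_apply, ← add_sum_erase _ _ (mem_univ i), add_sub_cancel_left]
    refine dvd_sum fun j hj => dvd_mul_of_dvd_right (dvd_mul_of_dvd_left
      (dvd_prod_of_mem (fun j => affPoly (c j) (m j)) ?_) _) _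
    simpa using (mem_erase.1 hj).1.symm
  choose r hr using hr
  have heval {i k : Fin 4} (hik : i ≠ k) : eval (v k) φ = r i := by
    have := map_dvd (eval (v k)) (hr i)
    rwa [h.eval_vertex_affPoly, if_neg hik, zero_dvd_iff, map_sub, eval_C, sub_eq_zero] at this
  have hr0 (i : Fin 4) : r i = r 0 := by
    obtain ⟨k, hik, h0k⟩ : ∃ k, i ≠ k ∧ 0 ≠ k := by decide +revert
    rw [← heval hik, heval h0k]
  obtain ⟨s, hs⟩ := h.prod_affPoly_dvd fun i => hr0 i ▸ hr i
  exact ⟨r 0, s, by rw [← hs]; ring⟩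

theorem pderiv_prod_mul (h : IsBarycentric v m c) (r : MvPolynomial (Fin 3) ℝ) (l : Fin 3) :
    pderiv l ((∏ i, affPoly (c i) (m i)) * r) =
      cupL m c (fun i => r + affPoly (c i) (m i) * dirDeriv (v i) r) l := by
  have hr : pderiv l r = ∑ i, C (m i l) * dirDeriv (v i) r := by
    simp only [dirDeriv_apply, mul_sum, ← mul_assoc, ← C_mul]
    rw [sum_comm]
    simp only [← sum_mul, ← map_sum, mul_comm (m _ _), h.sum_grad_mul]
    simp
  rw [cupL_apply, pderiv_mul, Derivation.leibniz_finsetProd, hr, sum_mul, mul_sum,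
    ← sum_add_distrib]
  refine sum_congr rfl fun i _ => ?_
  rw [pderiv_affPoly, ← mul_prod_erase _ _ (mem_univ i)]
  ring

theorem exists_gradWeightL_eq (h : IsBarycentric v m c) {t : ℕ}
    {p : Fin 4 → MvPolynomial (Fin 3) ℝ} (hp : ∀ i, p i ∈ polyLT (t + 1))
    (hcurl : curlL (cupL m c p) = 0) :
    ∃ r ∈ polyLT (t + 1), ∃ s ∈ polyLT t, gradWeightL v m c (r, s) = p := by
  obtain ⟨φ, hφ⟩ := exists_potential_of_curlL_eq_zero hcurl
  obtain ⟨a, r, hr⟩ := h.exists_eq_prod_mul_of_pderiv_eq_cupL hφ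
  have hcup (l : Fin 3) : cupL m c p l ∈ polyLT (t + 4) :=
    cupL_apply m c p l ▸ sum_mem fun i _ => cup_mem_polyLT (hp i) m c i _
  have hφd : φ ∈ polyLT (t + 5) := mem_polyLT_of_pderiv_mem fun l => hφ l ▸ hcup l
  have hrd : r ∈ polyLT (t + 1) := by
    refine h.mem_polyLT_of_prod_mul_mem univ ?_
    rw [← sub_eq_iff_eq_add'.2 hr]
    exact sub_mem hφd (mem_polyLT_succ_iff.2 (by simp))
  have hwd (i : Fin 4) : dirDeriv (v i) r ∈ polyLT t := by
    rw [dirDeriv_apply]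
    refine sum_mem fun l _ => ?_
    rw [C_mul']
    exact Submodule.smul_mem _ _ (pderiv_mem_polyLT hrd l)
  set w : Fin 4 → MvPolynomial (Fin 3) ℝ := fun i => r + affPoly (c i) (m i) * dirDeriv (v i) r
    with hw
  have hzero (l : Fin 3) : cupL m c (p - w) l = 0 := by
    rw [map_sub, Pi.sub_apply, ← hφ, hr, map_add, pderiv_C, zero_add, h.pderiv_prod_mul, sub_self]
  simp only [cupL_apply] at hzero
  have heq := h.eq_of_sum_C_mul_eq_zero hzero
  set H := ∑ i, C (c i) * ((∏ j ∈ univ.erase i, affPoly (c j) (m j)) * (p - w) i)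
  have hH : ∏ i, affPoly (c i) (m i) ∣ H := h.prod_affPoly_dvd fun i => by
    obtain ⟨j, hj⟩ := exists_ne i
    exact heq j ▸ dvd_mul_of_dvd_left
      (dvd_prod_of_mem (fun j => affPoly (c j) (m j)) (by simp [hj.symm])) _
  obtain ⟨s, hs⟩ := hH
  have hq (i : Fin 4) : (p - w) i = affPoly (c i) (m i) * s := by
    have hne : ∏ j ∈ univ.erase i, affPoly (c j) (m j) ≠ 0 := prod_ne_zero_iff.2 fun j _ => by
      obtain ⟨t, ht⟩ := h.exists_transversal j
      exact affPoly_ne_zero ht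
    apply mul_left_cancel₀ hne
    rw [heq, hs, ← mul_prod_erase _ _ (mem_univ i)]
    ring
  refine ⟨r, hrd, s, ?_, ?_⟩
  · obtain ⟨t, ht⟩ := h.exists_transversal 0
    refine mem_polyLT_of_mul_mem (totalDegree_affPoly (c := c 0) ht) ?_
    rw [← hq]
    refine sub_mem (hp 0) (add_mem hrd ?_)
    rw [add_comm]
    exact mul_mem_polyLT (affPoly_mem_polyLT _ _) (hwd 0)
  · ext1 i
    rw [gradWeightL_apply, ← hq, Pi.sub_apply]
    ring

theorem finiteDimensional_Zspace (h : IsBarycentric v m c) (k : ℕ) :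
    FiniteDimensional ℝ (Zspace k v m) :=
  Submodule.finiteDimensional_of_le (S₂ := LinearMap.range
    ((polyLT (k + 1)).subtype.compLeft (Fin 3))) fun z hz =>
      ⟨fun l => ⟨z l, (h.mem_Zspace_iff.1 hz).1 l⟩, rfl⟩

theorem le_finrank_curlL_Cspace (h : IsBarycentric v m c) (t : ℕ) :
    3 * (t + 3).choose 3 ≤ Module.finrank ℝ ((Cspace (t + 3) m fun i =>
      affPoly (c i) (m i)).map curlL) +
      (t + 2).choose 3 := by
  let ι := (polyLT (t + 1)).subtype.compLeft (Fin 4)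
  have hι : Function.Injective ι := fun p q hpq =>
    funext fun i => Subtype.ext (congrFun hpq i)
  let Φ := (curlL.comp (cupL m c)).comp ι
  have hker : (LinearMap.ker Φ).map ι ≤ LinearMap.range ((gradWeightL v m c).comp
      ((polyLT (t + 1)).subtype.prodMap (polyLT t).subtype)) := by
    rintro _ ⟨p, hp, rfl⟩
    obtain ⟨r, hr, s, hs, hrs⟩ := h.exists_gradWeightL_eq (p := ι p) (fun i => (p i).2) hp
    exact ⟨(⟨r, hr⟩, ⟨s, hs⟩), hrs⟩
  have hrange : LinearMap.range Φ ≤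
      (Cspace (t + 3) m fun i => affPoly (c i) (m i)).map curlL := by
    rintro _ ⟨p, rfl⟩
    refine Submodule.mem_map_of_mem ?_
    have : cupL m c (ι p) = ∑ i, fun l =>
        C (m i l) * ((∏ j ∈ univ.erase i, affPoly (c j) (m j)) *
          (p i : MvPolynomial (Fin 3) ℝ)) := by
      ext1 l
      rw [cupL_apply, Finset.sum_apply]
      rfl
    rw [this]
    exact sum_mem fun i _ => Submodule.subset_span
      ⟨i, p i, mem_polyLT_succ_iff.1 (p i).2, rfl⟩
  have := h.finiteDimensional_Zspace (t + 2)
  have := Submodule.finiteDimensional_of_le (h.curlL_Cspace_le t)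
  have h1 := Submodule.finrank_mono hrange
  have h2 := (Submodule.finrank_mono hker).trans (LinearMap.finrank_range_le _)
  have h3 := LinearMap.finrank_range_add_finrank_ker Φ
  rw [(Submodule.equivMapOfInjective ι hι _).finrank_eq.symm, Module.finrank_prod,
    finrank_polyLT, finrank_polyLT] at h2
  rw [Module.finrank_pi_fintype] at h3
  simp only [finrank_polyLT, Finset.sum_const, card_univ, Fintype.card_fin, smul_eq_mul] at h3
  simp only [add_assoc, Nat.reduceAdd] at *
  omega

theorem Zspace_eq_and_finrank (h : IsBarycentric v m c) (t : ℕ) :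
    Zspace (t + 2) v m = (Cspace (t + 3) m fun i => affPoly (c i) (m i)).map curlL ∧
      Module.finrank ℝ (Zspace (t + 2) v m) + (t + 2).choose 3 = 3 * (t + 3).choose 3 := by
  have := h.finiteDimensional_Zspace (t + 2)
  have h1 := h.le_finrank_curlL_Cspace t
  have h2 := Submodule.finrank_mono (h.curlL_Cspace_le t)
  have h3 := h.finrank_Zspace_add_le (t + 1)
  have e0 := six_mul_choose_three t
  have e1 := six_mul_choose_three (t + 1)
  have e2 := six_mul_choose_three (t + 2)
  have e3 := six_mul_choose_three (t + 3)
  rw [add_assoc t 1 1] at h3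
  simp only [add_assoc, Nat.reduceAdd] at h3 e1 e2 e3
  have key : (t + 5).choose 3 + 3 * (t + 3).choose 3 =
      3 * (t + 4).choose 3 + (t + 2).choose 3 + 1 := by
    nlinarith
  exact ⟨(Submodule.eq_of_le_of_finrank_le (h.curlL_Cspace_le t) (by omega)).symm, by omega⟩

end IsBarycentric

theorem Zspace_smul (k : ℕ) (v n : Fin 4 → Fin 3 → ℝ) {a : Fin 4 → ℝ} (ha : ∀ i, a i ≠ 0) :
    Zspace k v (fun i => a i • n i) = Zspace k v n := by
  have (i : Fin 4) (x : Fin 3 → ℝ) :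
      normalEvalL (a i • n i) x = a i • normalEvalL (n i) x := by
    simp [normalEvalL, smul_sum, mul_smul]
  simp only [Zspace, this, LinearMap.ker_smul _ _ (ha _)]

theorem Cspace_smul_le (s : ℕ) (n : Fin 4 → Fin 3 → ℝ) (lam : Fin 4 → MvPolynomial (Fin 3) ℝ)
    (a : Fin 4 → ℝ) :
    Cspace s (fun i => a i • n i) (fun i => C (a i) * lam i) ≤ Cspace s n lam := by
  refine Submodule.span_le.2 ?_
  rintro _ ⟨i, p, hp, rfl⟩
  refine Submodule.subset_span ⟨i, C (∏ j, a j) * p, ?_, funext fun l => ?_⟩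
  · rw [C_mul']
    exact (totalDegree_smul_le _ _).trans hp
  · rw [prod_mul_distrib, ← mul_prod_erase _ a (mem_univ i)]
    simp
    ring

theorem Cspace_smul (s : ℕ) (n : Fin 4 → Fin 3 → ℝ) (lam : Fin 4 → MvPolynomial (Fin 3) ℝ)
    {a : Fin 4 → ℝ} (ha : ∀ i, a i ≠ 0) :
    Cspace s (fun i => a i • n i) (fun i => C (a i) * lam i) = Cspace s n lam := by
  refine le_antisymm (Cspace_smul_le s n lam a) ?_
  have := Cspace_smul_le s (fun i => a i • n i) (fun i => C (a i) * lam i) fun i => (a i)⁻¹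
  simpa [smul_smul, ← mul_assoc, ← C_mul, ha] using this

/-- for a tetrahedron `E` and `k ≥ 2`, `Z_k = curl(C_{k+1})` and
`dim Z_k = 3 π_{k-2,3} - π_{k-3,3}`. -/
theorem Zk_eq_curl_cups_and_dim (k : ℕ) (hk : 2 ≤ k)
    (v n : Fin 4 → Fin 3 → ℝ) (c : Fin 4 → ℝ)
    (lam : Fin 4 → MvPolynomial (Fin 3) ℝ)
    (hv : AffineIndependent ℝ v)
    (hlam : ∀ i, lam i = C (c i) + ∑ j, C (n i j) * X j)
    (hunit : ∀ i, ∑ j, (n i j) ^ 2 = 1)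
    (hvanish : ∀ i j, j ≠ i → MvPolynomial.eval (v j) (lam i) = 0)
    (hout : ∀ i, MvPolynomial.eval (v i) (lam i) < 0) :
    Zspace k v n = Submodule.map curlL (Cspace (k + 1) n lam) ∧
    (Module.finrank ℝ (Zspace k v n) : ℤ) =
      3 * pi3 ((k : ℤ) - 2) - pi3 ((k : ℤ) - 3) := by
  obtain ⟨t, rfl⟩ := Nat.exists_eq_add_of_le' hk
  set a : Fin 4 → ℝ := fun i => eval (v i) (lam i) with ha
  have ha0 (i : Fin 4) : a i ≠ 0 := (hout i).ne
  set m : Fin 4 → Fin 3 → ℝ := fun i => (a i)⁻¹ • n i with hm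
  have hb : IsBarycentric v m fun i => (a i)⁻¹ * c i := by
    refine isBarycentric_of_eval_vertex fun i j => ?_
    have hij : (a i)⁻¹ * c i + ∑ l, m i l * v j l = (a i)⁻¹ * eval (v j) (lam i) := by
      simp [hlam, hm, mul_add, mul_sum, mul_assoc]
    rw [hij]
    split_ifs with h
    · exact h ▸ inv_mul_cancel₀ (ha0 i)
    · rw [hvanish i j (Ne.symm h), mul_zero]
  have hn : n = fun i => a i • m i := by
    ext1 i
    rw [hm, smul_inv_smul₀ (ha0 i)]
  have hl : lam = fun i => C (a i) * affPoly ((a i)⁻¹ * c i) (m i) := by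
    ext1 i
    simp only [hlam i, affPoly, mul_add, mul_sum, ← mul_assoc, ← C_mul, hm, Pi.smul_apply,
      smul_eq_mul, mul_inv_cancel₀ (ha0 i), one_mul]
  obtain ⟨hZ, hdim⟩ := hb.Zspace_eq_and_finrank t
  have hZn : Zspace (t + 2) v n = Zspace (t + 2) v m := by
    rw [hn, Zspace_smul _ _ _ ha0]
  have hCn : Cspace (t + 2 + 1) n lam =
      Cspace (t + 3) m fun i => affPoly ((a i)⁻¹ * c i) (m i) := by
    rw [hn, hl, Cspace_smul _ _ _ ha0]
  rw [hZn, hCn]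
  refine ⟨hZ, ?_⟩
  have h1 : pi3 (((t + 1 : ℕ) : ℤ) - 1) = (t + 3).choose 3 := pi3_natCast_sub_one (t + 1)
  have h0 := pi3_natCast_sub_one t
  have e1 : ((t + 2 : ℕ) : ℤ) - 2 = ((t + 1 : ℕ) : ℤ) - 1 := by push_cast; ring
  have e0 : ((t + 2 : ℕ) : ℤ) - 3 = (t : ℤ) - 1 := by push_cast; ring
  rw [e1, e0, h1, h0]
  omega
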